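/- Let σ be a periodic slope itinerary of length n containing at least two −'s (non single minus), and let H be a nonempty connected component of the set of parameters (a,b) ∈ ℝ/ℤ × [0,1) such that f_{a,b} has an attracting periodic orbit with slope itinerary σ. Then the distance from H to ℝ/ℤ × {1} is strictly positive; in particular H is an eye. -/

import Mathlib

open Set Filter Topology

noncomputable section

/-- Representative of a point of the circle in `[0,1)`. -/
noncomputable def rep (z : UnitAddCircle) : ℝ := (AddCircle.equivIco 1 0 z).val

/-- The straight sine map on `[0,1)`. -/
noncomputable def Sfun (t : ℝ) : ℝ := if t ≤ 1/2 then 4*t - 1 else -4*t + 3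

/-- The piecewise linear perturbation of the doubling map. -/
noncomputable def plpdm (a : UnitAddCircle) (b : ℝ) (z : UnitAddCircle) : UnitAddCircle :=
  ((2 * rep z + (b/2) * Sfun (rep z) : ℝ) : UnitAddCircle) + a

/-- The doubling map. -/
def Dbl (z : UnitAddCircle) : UnitAddCircle := z + z

/-- `x` is an attracting periodic point of `f` of exact period `n`. -/
def IsAttractingPeriodicPt (f : UnitAddCircle → UnitAddCircle) (n : ℕ)
    (x : UnitAddCircle) : Prop :=
  0 < n ∧ f^[n] x = x ∧ (∀ m, 0 < m → m < n → f^[m] x ≠ x) ∧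
  ∃ U : Set UnitAddCircle, IsOpen U ∧ IsConnected U ∧ x ∈ U ∧ f^[n] '' U ⊆ U ∧
    ∀ y ∈ U, Tendsto (fun k => f^[n*k] y) atTop (nhds x)

/-- Forward orbit of `x` under `f`. -/
def orbitSet (f : UnitAddCircle → UnitAddCircle) (x : UnitAddCircle) : Set UnitAddCircle :=
  {y | ∃ i, f^[i] x = y}

/-- Basin of attraction of the set `O`. -/
def basin (f : UnitAddCircle → UnitAddCircle) (O : Set UnitAddCircle) : Set UnitAddCircle :=
  {y | Tendsto (fun k => Metric.infDist (f^[k] y) O) atTop (nhds 0)}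

/-- Immediate basin of attraction of the orbit `O`. -/
def immBasin (f : UnitAddCircle → UnitAddCircle) (O : Set UnitAddCircle) :
    Set UnitAddCircle :=
  ⋃ z ∈ O, connectedComponentIn (basin f O) z

/-- The hyperbolic set `H`. -/
def hypSet : Set (UnitAddCircle × ℝ) :=
  {q | q.2 ∈ Set.Ico (0:ℝ) 1 ∧ ∃ n x, IsAttractingPeriodicPt (plpdm q.1 q.2) n x}

/-- The lift `F_{a,b}` of `f_{a,b}`, normalized so that `F_{a,b}(0) ∈ [0,1)`. -/
noncomputable def liftF (a : UnitAddCircle) (b : ℝ) (x : ℝ) : ℝ :=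
  (2 * Int.fract x + rep a + (b/2) * Sfun (Int.fract x)
    + (if rep a - b/2 < 0 then 1 else 0)) + 2 * (⌊x⌋ : ℝ)

/-- `Φ_{a,b}`, the limit of `F_{a,b}^n(x)/2^n`. -/
noncomputable def Phi (a : UnitAddCircle) (b : ℝ) (x : ℝ) : ℝ :=
  limUnder atTop (fun n : ℕ => (liftF a b)^[n] x / 2 ^ n)

/-- The semiconjugacy `φ_{a,b}` induced by `Φ_{a,b}`. -/
noncomputable def phiMap (a : UnitAddCircle) (b : ℝ) (z : UnitAddCircle) : UnitAddCircle :=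
  ((Phi a b (rep z) : ℝ) : UnitAddCircle)

/-- The arc `I₊ = [0,1/2]` of the circle. -/
def Iplus : Set UnitAddCircle := (fun t : ℝ => (t : UnitAddCircle)) '' Set.Icc 0 (1/2)

/-- The arc `I₋ = [1/2,1]` of the circle. -/
def Iminus : Set UnitAddCircle := (fun t : ℝ => (t : UnitAddCircle)) '' Set.Icc (1/2) 1

/-- The orbit of `x` (of period `p`) avoids `0`, `1/2` and has slope itinerary `σ`,
where `σ j = true` encodes the symbol `−` and `σ j = false` encodes `+`. -/
def HasItinerary (f : UnitAddCircle → UnitAddCircle) (p : ℕ) (x : UnitAddCircle)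
    (σ : Fin p → Bool) : Prop :=
  (∀ j : Fin p, f^[(j : ℕ)] x ≠ (0 : UnitAddCircle) ∧
      f^[(j : ℕ)] x ≠ (((1:ℝ)/2 : ℝ) : UnitAddCircle)) ∧
  ∀ j : Fin p, (σ j = true → f^[(j : ℕ)] x ∈ Iminus) ∧ (σ j = false → f^[(j : ℕ)] x ∈ Iplus)

/-- The set `P_σ` of parameters whose attracting orbit has slope itinerary `σ`. -/
def paramSet (p : ℕ) (σ : Fin p → Bool) : Set (UnitAddCircle × ℝ) :=
  {q | q.2 ∈ Set.Ico (0:ℝ) 1 ∧ ∃ x, IsAttractingPeriodicPt (plpdm q.1 q.2) p x ∧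
       HasItinerary (plpdm q.1 q.2) p x σ}

/-- `S` is a tongue: its closure meets `ℝ/ℤ × {1}` in a nondegenerate interval. -/
def IsTongue (S : Set (UnitAddCircle × ℝ)) : Prop :=
  ∃ u v : ℝ, u < v ∧ ∀ t ∈ Set.Icc u v, (((t : ℝ) : UnitAddCircle), (1:ℝ)) ∈ closure S

end


lemma coe_rep (z : UnitAddCircle) : ((rep z : ℝ) : UnitAddCircle) = z :=
  (AddCircle.equivIco 1 0).symm_apply_apply z

lemma rep_mem (z : UnitAddCircle) : 0 ≤ rep z ∧ rep z < 1 := by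
  have h := (AddCircle.equivIco 1 0 z).2
  exact ⟨h.1, by simpa [rep] using h.2⟩

lemma norm_coe_of_le_half {t : ℝ} (h0 : 0 ≤ t) (h1 : t ≤ 1 / 2) :
    ‖(t : UnitAddCircle)‖ = t := by
  have h := (AddCircle.norm_coe_eq_abs_iff (p := 1) (x := t) one_ne_zero).2
    (by rw [abs_of_nonneg h0]; simpa using h1)
  rw [h, abs_of_nonneg h0]

lemma norm_coe_of_half_le {t : ℝ} (h0 : 1 / 2 ≤ t) (h1 : t ≤ 1) :
    ‖(t : UnitAddCircle)‖ = 1 - t := by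
  have h := norm_coe_of_le_half (t := 1 - t) (by linarith) (by linarith)
  rw [← h, ← norm_neg, AddCircle.coe_sub, AddCircle.coe_period, zero_sub]

lemma Sfun_rep (z : UnitAddCircle) : Sfun (rep z) = 4 * ‖z‖ - 1 := by
  obtain ⟨h0, h1⟩ := rep_mem z
  conv_rhs => rw [← coe_rep z]
  unfold Sfun
  split_ifs with h
  · rw [norm_coe_of_le_half h0 h]
  · rw [norm_coe_of_half_le (by linarith) h1.le]
    ring

/-- A lift of `plpdm a b` to the real line. -/
noncomputable def realLift (a : UnitAddCircle) (b t : ℝ) : ℝ :=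
  2 * t + (b / 2) * (4 * ‖(t : UnitAddCircle)‖ - 1) + rep a

lemma realLift_semiconj (a : UnitAddCircle) (b : ℝ) :
    Function.Semiconj (fun t : ℝ => (t : UnitAddCircle)) (realLift a b) (plpdm a b) := by
  intro t
  simp only [realLift, plpdm, Sfun_rep, two_mul, AddCircle.coe_add, coe_rep]

lemma norm_coe_sub_norm_coe_le (s t : ℝ) :
    |‖(s : UnitAddCircle)‖ - ‖(t : UnitAddCircle)‖| ≤ |s - t| := by
  refine (abs_norm_sub_norm_le _ _).trans ?_
  rw [← AddCircle.coe_sub]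
  exact QuotientAddGroup.norm_mk_le_norm

lemma realLift_strictMono (a : UnitAddCircle) {b : ℝ} (hb0 : 0 ≤ b) (hb1 : b < 1) :
    StrictMono (realLift a b) := by
  intro s t hst
  have h := neg_le_of_abs_le (norm_coe_sub_norm_coe_le t s)
  rw [abs_of_pos (sub_pos.2 hst)] at h
  unfold realLift
  nlinarith [mul_le_mul_of_nonneg_left h hb0]

lemma realLift_lipschitz (a : UnitAddCircle) {b : ℝ} (hb0 : 0 ≤ b) (hb1 : b < 1) :
    LipschitzWith 4 (realLift a b) := by
  refine LipschitzWith.of_dist_le_mul fun s t => ?_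
  have h : |(b * 2) * (‖(s : UnitAddCircle)‖ - ‖(t : UnitAddCircle)‖)| ≤ 2 * |s - t| := by
    rw [abs_mul, abs_of_nonneg (by linarith)]
    exact mul_le_mul (by linarith) (norm_coe_sub_norm_coe_le s t) (abs_nonneg _) (by norm_num)
  rw [Real.dist_eq, Real.dist_eq]
  calc |realLift a b s - realLift a b t|
      = |2 * (s - t) + (b * 2) * (‖(s : UnitAddCircle)‖ - ‖(t : UnitAddCircle)‖)| := by
        unfold realLift; ring_nf
    _ ≤ |2 * (s - t)| + 2 * |s - t| := (abs_add_le _ _).trans (by gcongr)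
    _ = ((4 : NNReal) : ℝ) * |s - t| := by
        rw [abs_mul, abs_two]; push_cast; ring

lemma abs_realLift_sub_le (a : UnitAddCircle) {b s t : ℝ} (hb1 : b < 1)
    (hs : s ∈ Icc (1 / 2 : ℝ) 1) (ht : t ∈ Icc (1 / 2 : ℝ) 1) :
    |realLift a b s - realLift a b t| ≤ 1 - b := by
  have h : realLift a b s - realLift a b t = 2 * (1 - b) * (s - t) := by
    simp only [realLift, norm_coe_of_half_le hs.1 hs.2, norm_coe_of_half_le ht.1 ht.2]
    ring
  have hst : |s - t| ≤ 1 / 2 := abs_le.2 ⟨by linarith [hs.1, ht.2], by linarith [hs.2, ht.1]⟩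
  rw [h, abs_mul, abs_of_pos (by linarith)]
  nlinarith

lemma dist_iterate_le_geom_sum {X : Type*} [PseudoMetricSpace X] {K : NNReal} {G : X → X}
    (hG : LipschitzWith K G) (x : X) (n : ℕ) :
    dist x (G^[n] x) ≤ (∑ i ∈ Finset.range n, (K : ℝ) ^ i) * dist x (G x) := by
  rw [Finset.sum_mul]
  refine (dist_le_range_sum_dist (fun i => G^[i] x) n).trans (Finset.sum_le_sum fun i _ => ?_)
  have h := hG.dist_iterate_succ_le_geometric x i
  rwa [mul_comm]

/-- If two distinct points of an `n`-periodic orbit lie in `I₋`, then `b` is bounded away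
from `1`. -/
lemma one_le_geom_sum_mul_of_mem_Iminus {a : UnitAddCircle} {b : ℝ} (hb0 : 0 ≤ b) (hb1 : b < 1)
    {n i j : ℕ} (hij : i < j) (hjn : j < n) {x : UnitAddCircle}
    (hx : (plpdm a b)^[n] x = x) (hmin : ∀ m, 0 < m → m < n → (plpdm a b)^[m] x ≠ x)
    (hi : (plpdm a b)^[i] x ∈ Iminus) (hj : (plpdm a b)^[j] x ∈ Iminus) :
    1 ≤ (∑ k ∈ Finset.range n, ((4 : ℝ) ^ n) ^ k) * (1 - b) := by
  set f := plpdm a b with hf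
  set F := realLift a b with hF
  have hFf : Function.Semiconj (fun t : ℝ => (t : UnitAddCircle)) F f := realLift_semiconj a b
  obtain ⟨s, hs, hsi⟩ := hi
  obtain ⟨t, ht, htj⟩ := hj
  obtain ⟨e, rfl⟩ := Nat.exists_eq_add_of_lt hij
  have hst : |F s - F t| ≤ 1 - b := abs_realLift_sub_le a hb1 hs ht
  have hy : ((F s : ℝ) : UnitAddCircle) = f^[i + 1] x := by
    rw [Function.iterate_succ_apply', ← hsi]; exact hFf s
  have hz : ((F t : ℝ) : UnitAddCircle) = f^[e + 1] (f^[i + 1] x) := by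
    rw [← Function.iterate_add_apply, show e + 1 + (i + 1) = (i + e + 1) + 1 by ring,
      Function.iterate_succ_apply', ← htj]
    exact hFf t
  have hlift : ((F^[e + 1] (F s) : ℝ) : UnitAddCircle) = ((F t : ℝ) : UnitAddCircle) := by
    rw [hz, ← hy]; exact hFf.iterate_right (e + 1) (F s)
  obtain ⟨m, hm⟩ : ∃ m : ℤ, F^[e + 1] (F s) - m = F t := by
    rw [← sub_eq_zero, ← AddCircle.coe_sub, AddCircle.coe_eq_zero_iff] at hlift
    obtain ⟨m, hm⟩ := hlift
    exact ⟨m, by simp only [zsmul_eq_mul, mul_one] at hm; linarith⟩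
  set G : ℝ → ℝ := fun u => F^[e + 1] u - m with hG
  have hGmono : StrictMono G := fun u v huv =>
    sub_lt_sub_right ((realLift_strictMono a hb0 hb1).iterate (e + 1) huv) _
  have hGlip : LipschitzWith (4 ^ n) G := by
    have h := (realLift_lipschitz a hb0 hb1).iterate (e + 1)
    refine LipschitzWith.of_dist_le_mul fun u v => ?_
    have huv := h.dist_le_mul u v
    rw [dist_sub_right]
    refine huv.trans ?_
    push_cast
    gcongr
    · norm_num
    · omega
  have hGf : Function.Semiconj (fun t : ℝ => (t : UnitAddCircle)) G f^[e + 1] := by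
    intro u
    have hm0 : ((m : ℝ) : UnitAddCircle) = 0 :=
      (AddCircle.coe_eq_zero_iff 1).2 ⟨m, by simp⟩
    simp only [hG, AddCircle.coe_sub, hm0, sub_zero]
    exact hFf.iterate_right (e + 1) u
  have hper : (f^[e + 1])^[n] (f^[i + 1] x) = f^[i + 1] x := by
    have h : Function.IsPeriodicPt f n x := hx
    have h' := (h.apply_iterate (i + 1)).const_mul (e + 1)
    rwa [Function.IsPeriodicPt, Function.IsFixedPt, Function.iterate_mul] at h'
  obtain ⟨k, hk⟩ : ∃ k : ℤ, G^[n] (F s) - F s = k := by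
    have h : ((G^[n] (F s) : ℝ) : UnitAddCircle) = ((F s : ℝ) : UnitAddCircle) := by
      refine (hGf.iterate_right n (F s)).trans ?_
      rw [hy, hper]
    rw [← sub_eq_zero, ← AddCircle.coe_sub, AddCircle.coe_eq_zero_iff] at h
    obtain ⟨k, hk⟩ := h
    exact ⟨k, by simpa using hk.symm⟩
  have hn : 0 < n := by omega
  have hk0 : k ≠ 0 := by
    rintro rfl
    have hfixn : G^[n] (F s) = id^[n] (F s) := by
      rw [Function.iterate_id]
      simpa [sub_eq_zero] using hk
    have hfix : G (F s) = F s :=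
      ((Function.Commute.id_right (f := G)).iterate_pos_eq_iff_map_eq
        hGmono.monotone strictMono_id hn).1 hfixn
    have hyfix : f^[e + 1] (f^[i + 1] x) = f^[i + 1] x := by
      rw [← hy]
      exact (hGf (F s)).symm.trans (congrArg _ hfix)
    refine hmin (e + 1) (by omega) (by omega) ?_
    have h := congrArg f^[n - (i + 1)] hyfix
    rwa [← Function.iterate_add_apply, ← Function.iterate_add_apply,
      ← Function.iterate_add_apply, show n - (i + 1) + (e + 1) + (i + 1) = e + 1 + n by omega,
      show n - (i + 1) + (i + 1) = n by omega, Function.iterate_add_apply, hx] at h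
  have hk1 : (1 : ℝ) ≤ |(k : ℝ)| := by exact_mod_cast Int.one_le_abs hk0
  have hdist := dist_iterate_le_geom_sum hGlip (F s) n
  rw [show G (F s) = F t from hm, dist_comm, Real.dist_eq, Real.dist_eq, hk] at hdist
  push_cast at hdist
  exact hk1.trans (hdist.trans (by gcongr))

theorem stmt15 (n : ℕ) (σ : Fin n → Bool)
    (hσ : ∃ j₁ j₂ : Fin n, j₁ ≠ j₂ ∧ σ j₁ = true ∧ σ j₂ = true)
    (H : Set (UnitAddCircle × ℝ)) (q₀ : UnitAddCircle × ℝ) (hq₀ : q₀ ∈ paramSet n σ)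
    (hH : H = connectedComponentIn (paramSet n σ) q₀) :
    (∃ δ > (0:ℝ), ∀ q ∈ H, δ ≤ 1 - q.2) ∧ ¬ IsTongue H := by
  have hbound : ∃ δ > (0:ℝ), ∀ q ∈ H, δ ≤ 1 - q.2 := by
    set C : ℝ := ∑ k ∈ Finset.range n, ((4 : ℝ) ^ n) ^ k with hC
    obtain ⟨i, j, hij, hi, hj⟩ := hσ
    have hn : n ≠ 0 := (Fin.pos i).ne'
    have hCpos : 0 < C := Finset.sum_pos (fun k _ => by positivity) (by simpa using hn)
    refine ⟨1 / C, by positivity, fun q hq => ?_⟩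
    rw [hH] at hq
    obtain ⟨hb, x, ⟨-, hx, hmin, -⟩, -, hx'⟩ := connectedComponentIn_subset _ _ hq
    rw [div_le_iff₀' hCpos]
    rcases lt_or_gt_of_ne hij with h | h
    · exact one_le_geom_sum_mul_of_mem_Iminus hb.1 hb.2 h j.2 hx hmin
        ((hx' i).1 hi) ((hx' j).1 hj)
    · exact one_le_geom_sum_mul_of_mem_Iminus hb.1 hb.2 h i.2 hx hmin
        ((hx' j).1 hj) ((hx' i).1 hi)
  refine ⟨hbound, ?_⟩
  obtain ⟨δ, hδ, hH'⟩ := hbound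
  rintro ⟨u, v, huv, htongue⟩
  have hclosed : IsClosed {q : UnitAddCircle × ℝ | δ ≤ 1 - q.2} :=
    isClosed_le continuous_const (continuous_const.sub continuous_snd)
  have h := closure_minimal hH' hclosed (htongue u ⟨le_rfl, huv.le⟩)
  change δ ≤ 1 - (1 : ℝ) at h
  linarith
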